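/- Let κ satisfy the energy, consistency, and domination principles, and assume (A1) and (A2). Then for every set A ⊂ X there exists a σ-compact (K_σ) set A₀ ⊂ A, independent of μ, such that for all μ ∈ E⁺ the inner balayages satisfy μ^A = μ^{A₀}, and moreover the outer balayage μ^{*A₀} exists and μ^A = μ^{A₀} = μ^{*A₀}. -/

import Mathlib

open MeasureTheory Filter Topology Set
open scoped ENNReal NNReal

namespace Balayage

variable {X : Type*} [TopologicalSpace X] [T2Space X] [LocallyCompactSpace X]
  [MeasurableSpace X] [BorelSpace X]

/-- The potential `κμ(x) := ∫ κ(x,y) dμ(y)`. -/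
noncomputable def pot (κ : X → X → ℝ≥0∞) (μ : Measure X) (x : X) : ℝ≥0∞ :=
  ∫⁻ y, κ x y ∂μ

/-- The mutual energy `κ(μ,ν) := ∬ κ(x,y) d(μ⊗ν)(x,y)`. -/
noncomputable def energy (κ : X → X → ℝ≥0∞) (μ ν : Measure X) : ℝ≥0∞ :=
  ∫⁻ x, pot κ ν x ∂μ

/-- A positive Radon measure: locally finite and inner regular. -/
def IsRadon (μ : Measure X) : Prop :=
  μ.InnerRegular ∧ IsLocallyFiniteMeasure μ

/-- `E⁺`: the positive Radon measures of finite energy. -/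
def Eplus (κ : X → X → ℝ≥0∞) : Set (Measure X) :=
  {μ | IsRadon μ ∧ energy κ μ μ < ⊤}

/-- `μ` is concentrated on `A`: `A` is `μ`-measurable and `X∖A` is locally `μ`-negligible. -/
def ConcOn (μ : Measure X) (A : Set X) : Prop :=
  NullMeasurableSet A μ ∧ ∀ K : Set X, IsCompact K → μ (Aᶜ ∩ K) = 0

/-- `E⁺_A`: measures of finite energy concentrated on `A`. -/
def EplusOn (κ : X → X → ℝ≥0∞) (A : Set X) : Set (Measure X) :=
  {μ ∈ Eplus κ | ConcOn μ A}

/-- The inner capacity `c_*(A)`. -/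
noncomputable def innerCap (κ : X → X → ℝ≥0∞) (A : Set X) : ℝ≥0∞ :=
  (⨅ μ ∈ {μ ∈ EplusOn κ A | μ Set.univ = 1}, energy κ μ μ)⁻¹

/-- `P` holds nearly everywhere on `A`: the set where it fails has inner capacity zero. -/
def NEOn (κ : X → X → ℝ≥0∞) (A : Set X) (P : X → Prop) : Prop :=
  innerCap κ {x | x ∈ A ∧ ¬ P x} = 0

/-- The outer capacity `c^*(A)`. -/
noncomputable def outerCap (κ : X → X → ℝ≥0∞) (A : Set X) : ℝ≥0∞ :=
  ⨅ D ∈ {D : Set X | IsOpen D ∧ A ⊆ D}, innerCap κ D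

/-- `P` holds quasi-everywhere on `A`: the set where it fails has outer capacity zero. -/
def QEOn (κ : X → X → ℝ≥0∞) (A : Set X) (P : X → Prop) : Prop :=
  outerCap κ {x | x ∈ A ∧ ¬ P x} = 0

/-- The class `Λ_{A,μ}` of measures `ν ∈ E⁺` with `κν ≥ κμ` n.e. on `A`. -/
def InnerLam (κ : X → X → ℝ≥0∞) (A : Set X) (μ : Measure X) : Set (Measure X) :=
  {ν ∈ Eplus κ | NEOn κ A (fun x => pot κ μ x ≤ pot κ ν x)}

/-- The class `Λ*_{A,μ}` of measures `ν ∈ E⁺` with `κν ≥ κμ` q.e. on `A`. -/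
def OuterLam (κ : X → X → ℝ≥0∞) (A : Set X) (μ : Measure X) : Set (Measure X) :=
  {ν ∈ Eplus κ | QEOn κ A (fun x => pot κ μ x ≤ pot κ ν x)}

/-- `b` is the inner balayage `μ^A`: the measure of minimal potential in `Λ_{A,μ}`. -/
def IsInnerBal (κ : X → X → ℝ≥0∞) (A : Set X) (μ b : Measure X) : Prop :=
  b ∈ InnerLam κ A μ ∧ ∀ ν ∈ InnerLam κ A μ, ∀ x, pot κ b x ≤ pot κ ν x

/-- `b` is the outer balayage `μ^{*A}`: the measure of minimal potential in `Λ*_{A,μ}`. -/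
def IsOuterBal (κ : X → X → ℝ≥0∞) (A : Set X) (μ b : Measure X) : Prop :=
  b ∈ OuterLam κ A μ ∧ ∀ ν ∈ OuterLam κ A μ, ∀ x, pot κ b x ≤ pot κ ν x

/-- The strong (energy) distance `‖μ − ν‖`. -/
noncomputable def strDist (κ : X → X → ℝ≥0∞) (μ ν : Measure X) : ℝ :=
  Real.sqrt ((energy κ μ μ).toReal - 2 * (energy κ μ ν).toReal + (energy κ ν ν).toReal)

/-- The energy principle (strict positive definiteness). -/
def EnergyPrinciple (κ : X → X → ℝ≥0∞) : Prop :=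
  ∀ μ ∈ Eplus κ, ∀ ν ∈ Eplus κ,
    2 * energy κ μ ν ≤ energy κ μ μ + energy κ ν ν ∧
      (2 * energy κ μ ν = energy κ μ μ + energy κ ν ν → μ = ν)

/-- Vague convergence of a net of measures along a filter. -/
def VagueConv {ι : Type*} (F : Filter ι) (m : ι → Measure X) (ν : Measure X) : Prop :=
  ∀ f : X → ℝ, Continuous f → HasCompactSupport f →
    Tendsto (fun i => ∫ x, f x ∂(m i)) F (nhds (∫ x, f x ∂ν))

/-- A net of measures is strong Cauchy (for the energy metric) along a filter. -/
def StrongCauchy (κ : X → X → ℝ≥0∞) {ι : Type*} (F : Filter ι) (m : ι → Measure X) : Prop :=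
  ∀ ε : ℝ, 0 < ε → ∃ s ∈ F, ∀ i ∈ s, ∀ j ∈ s, strDist κ (m i) (m j) < ε

/-- The consistency principle: every strong Cauchy net in `E⁺` converges strongly
to each of its vague limit points. -/
def Consistent (κ : X → X → ℝ≥0∞) : Prop :=
  ∀ (ι : Type) (F : Filter ι) (m : ι → Measure X), F.NeBot →
    (∀ i, m i ∈ Eplus κ) → StrongCauchy κ F m →
    ∀ ν : Measure X, (∃ G : Filter ι, G ≤ F ∧ G.NeBot ∧ VagueConv G m ν) →
      Tendsto (fun i => strDist κ (m i) ν) F (nhds 0)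

/-- The domination principle. -/
def Domination (κ : X → X → ℝ≥0∞) : Prop :=
  ∀ μ ∈ Eplus κ, ∀ ν ∈ Eplus κ,
    (∀ᵐ x ∂μ, pot κ μ x ≤ pot κ ν x) → ∀ x, pot κ μ x ≤ pot κ ν x

/-- A kernel: symmetric and lower semicontinuous. -/
structure IsKernel (κ : X → X → ℝ≥0∞) : Prop where
  symm : ∀ x y, κ x y = κ y x
  lsc : LowerSemicontinuous (Function.uncurry κ)

/-- `E'_A`: the strong closure of `E⁺_A` within `E⁺`. -/
def EclosOn (κ : X → X → ℝ≥0∞) (A : Set X) : Set (Measure X) :=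
  {ν ∈ Eplus κ | ∀ ε : ℝ, 0 < ε → ∃ μ ∈ EplusOn κ A, strDist κ ν μ < ε}

/-- The (real-valued) potential of the signed measure `λ = lp − lm`. -/
noncomputable def spot (κ : X → X → ℝ≥0∞) (lp lm : Measure X) (x : X) : ℝ :=
  (pot κ lp x).toReal - (pot κ lm x).toReal

/-- Assumption (A2): every `f ∈ C_c(X)` is the limit, uniformly with supports in one fixed
compact set, of a sequence of potentials of signed measures of finite energy that are
continuous and compactly supported. -/
def A2 (κ : X → X → ℝ≥0∞) : Prop :=
  ∀ f : X → ℝ, Continuous f → HasCompactSupport f →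
    ∃ (K : Set X) (lp lm : ℕ → Measure X), IsCompact K ∧ tsupport f ⊆ K ∧
      (∀ j, lp j ∈ Eplus κ ∧ lm j ∈ Eplus κ) ∧
      (∀ j x, pot κ (lp j) x ≠ ⊤ ∨ pot κ (lm j) x ≠ ⊤) ∧
      (∀ j, Continuous (spot κ (lp j) (lm j))) ∧
      (∀ j, tsupport (spot κ (lp j) (lm j)) ⊆ K) ∧
      TendstoUniformly (fun j => spot κ (lp j) (lm j)) f atTop
section Auxiliary

set_option linter.unusedSectionVars false

variable [SecondCountableTopology X] {κ : X → X → ℝ≥0∞}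

theorem IsKernel.measurable_uncurry (h : IsKernel κ) : Measurable (Function.uncurry κ) :=
  h.lsc.measurable

theorem isLocallyFiniteMeasure_of_mem_Eplus {μ : Measure X} (h : μ ∈ Eplus κ) :
    IsLocallyFiniteMeasure μ :=
  h.1.2

theorem mem_Eplus_of_energy_lt_top {μ : Measure X} [IsLocallyFiniteMeasure μ]
    (h : energy κ μ μ < ⊤) : μ ∈ Eplus κ :=
  ⟨⟨inferInstance, inferInstance⟩, h⟩

theorem measurable_pot (h : IsKernel κ) (μ : Measure X) [SFinite μ] : Measurable (pot κ μ) :=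
  h.measurable_uncurry.lintegral_prod_right'

theorem lowerSemicontinuous_pot (h : IsKernel κ) (μ : Measure X) :
    LowerSemicontinuous (pot κ μ) := by
  rw [lowerSemicontinuous_iff_le_liminf]
  intro x
  have hl : ∀ y, LowerSemicontinuous fun x => κ x y := fun y =>
    h.lsc.comp (g := fun x => (x, y)) (by fun_prop)
  have hr : ∀ x, LowerSemicontinuous fun y => κ x y := fun x =>
    h.lsc.comp (g := fun y => (x, y)) (by fun_prop)
  calc pot κ μ x ≤ ∫⁻ y, liminf (fun x' => κ x' y) (𝓝 x) ∂μ :=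
        lintegral_mono fun y => (lowerSemicontinuous_iff_le_liminf.1 (hl y)) x
    _ ≤ liminf (pot κ μ) (𝓝 x) := lintegral_liminf_le fun x => (hr x).measurable

theorem energy_comm (h : IsKernel κ) (μ ν : Measure X) [SFinite μ] [SFinite ν] :
    energy κ μ ν = energy κ ν μ := by
  unfold energy pot
  rw [lintegral_lintegral_swap h.measurable_uncurry.aemeasurable]
  simp_rw [h.symm]

theorem energy_add_left (μ ν σ : Measure X) :
    energy κ (μ + ν) σ = energy κ μ σ + energy κ ν σ :=
  lintegral_add_measure _ _ _

theorem energy_smul_left (c : ℝ≥0∞) (μ σ : Measure X) :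
    energy κ (c • μ) σ = c * energy κ μ σ :=
  lintegral_smul_measure _ _

theorem energy_smul_right (h : IsKernel κ) (c : ℝ≥0∞) (μ σ : Measure X) [SFinite σ] :
    energy κ μ (c • σ) = c * energy κ μ σ := by
  have : pot κ (c • σ) = fun x => c * pot κ σ x :=
    funext fun x => lintegral_smul_measure _ _
  unfold energy
  rw [this, lintegral_const_mul _ (measurable_pot h σ)]

theorem energy_mono {μ μ' ν ν' : Measure X} (h : μ ≤ μ') (h' : ν ≤ ν') :
    energy κ μ ν ≤ energy κ μ' ν' :=
  lintegral_mono' h fun _ => lintegral_mono' h' le_rfl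

theorem mem_Eplus_of_le {μ ν : Measure X} (h : μ ∈ Eplus κ) (hν : ν ≤ μ) : ν ∈ Eplus κ := by
  have := isLocallyFiniteMeasure_of_mem_Eplus h
  have : IsLocallyFiniteMeasure ν := Measure.isLocallyFiniteMeasure_of_le hν
  exact mem_Eplus_of_energy_lt_top ((energy_mono hν hν).trans_lt h.2)

theorem energy_lt_top (hE : EnergyPrinciple κ) {μ ν : Measure X} (hμ : μ ∈ Eplus κ)
    (hν : ν ∈ Eplus κ) : energy κ μ ν < ⊤ := by
  have h := ((hE μ hμ ν hν).1).trans_lt (ENNReal.add_lt_top.2 ⟨hμ.2, hν.2⟩)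
  exact lt_of_le_of_lt (le_mul_of_one_le_left zero_le (by norm_num)) h

theorem zero_mem_Eplus : (0 : Measure X) ∈ Eplus κ :=
  mem_Eplus_of_energy_lt_top (by simp [energy])

theorem smul_mem_Eplus (h : IsKernel κ) {μ : Measure X} (hμ : μ ∈ Eplus κ) (c : ℝ≥0) :
    (c : ℝ≥0∞) • μ ∈ Eplus κ := by
  have := isLocallyFiniteMeasure_of_mem_Eplus hμ
  have : IsLocallyFiniteMeasure ((c : ℝ≥0∞) • μ) :=
    inferInstanceAs (IsLocallyFiniteMeasure (c • μ))
  apply mem_Eplus_of_energy_lt_top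
  rw [energy_smul_left, energy_smul_right h]
  exact ENNReal.mul_lt_top ENNReal.coe_lt_top (ENNReal.mul_lt_top ENNReal.coe_lt_top hμ.2)

theorem add_mem_Eplus (h : IsKernel κ) (hE : EnergyPrinciple κ) {μ ν : Measure X}
    (hμ : μ ∈ Eplus κ) (hν : ν ∈ Eplus κ) : μ + ν ∈ Eplus κ := by
  have := isLocallyFiniteMeasure_of_mem_Eplus hμ
  have := isLocallyFiniteMeasure_of_mem_Eplus hν
  have : IsLocallyFiniteMeasure (μ + ν) := by
    refine ⟨fun x => ?_⟩
    obtain ⟨s, hs, hs'⟩ := μ.finiteAt_nhds x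
    obtain ⟨t, ht, ht'⟩ := ν.finiteAt_nhds x
    refine ⟨s ∩ t, inter_mem hs ht, ?_⟩
    rw [Measure.add_apply]
    exact ENNReal.add_lt_top.2 ⟨(measure_mono inter_subset_left).trans_lt hs',
      (measure_mono inter_subset_right).trans_lt ht'⟩
  apply mem_Eplus_of_energy_lt_top
  rw [energy_add_left, energy_comm h μ, energy_comm h ν, energy_add_left, energy_add_left]
  exact ENNReal.add_lt_top.2 ⟨ENNReal.add_lt_top.2 ⟨hμ.2, energy_lt_top hE hν hμ⟩,
    ENNReal.add_lt_top.2 ⟨energy_lt_top hE hμ hν, hν.2⟩⟩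

/-- The real-valued mutual energy. -/
noncomputable def renergy (κ : X → X → ℝ≥0∞) (μ ν : Measure X) : ℝ := (energy κ μ ν).toReal

theorem renergy_nonneg (μ ν : Measure X) : 0 ≤ renergy κ μ ν := ENNReal.toReal_nonneg

theorem renergy_comm (h : IsKernel κ) {μ ν : Measure X} (hμ : μ ∈ Eplus κ) (hν : ν ∈ Eplus κ) :
    renergy κ μ ν = renergy κ ν μ := by
  have := isLocallyFiniteMeasure_of_mem_Eplus hμ
  have := isLocallyFiniteMeasure_of_mem_Eplus hν
  rw [renergy, renergy, energy_comm h]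

theorem renergy_add_left (hE : EnergyPrinciple κ) {μ ν σ : Measure X} (hμ : μ ∈ Eplus κ)
    (hν : ν ∈ Eplus κ) (hσ : σ ∈ Eplus κ) :
    renergy κ (μ + ν) σ = renergy κ μ σ + renergy κ ν σ := by
  rw [renergy, energy_add_left,
    ENNReal.toReal_add (energy_lt_top hE hμ hσ).ne (energy_lt_top hE hν hσ).ne]
  rfl

theorem renergy_smul_left (c : ℝ≥0) (μ σ : Measure X) :
    renergy κ ((c : ℝ≥0∞) • μ) σ = c * renergy κ μ σ := by
  rw [renergy, energy_smul_left, ENNReal.toReal_mul]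
  rfl

theorem renergy_add_right (h : IsKernel κ) (hE : EnergyPrinciple κ) {μ ν σ : Measure X}
    (hμ : μ ∈ Eplus κ) (hν : ν ∈ Eplus κ) (hσ : σ ∈ Eplus κ) :
    renergy κ σ (μ + ν) = renergy κ σ μ + renergy κ σ ν := by
  rw [renergy_comm h hσ (add_mem_Eplus h hE hμ hν), renergy_add_left hE hμ hν hσ,
    renergy_comm h hσ hμ, renergy_comm h hσ hν]

theorem renergy_smul_right (h : IsKernel κ) (c : ℝ≥0) {μ σ : Measure X} (hμ : μ ∈ Eplus κ)
    (hσ : σ ∈ Eplus κ) : renergy κ σ ((c : ℝ≥0∞) • μ) = c * renergy κ σ μ := by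
  rw [renergy_comm h hσ (smul_mem_Eplus h hμ c), renergy_smul_left, renergy_comm h hσ hμ]

theorem two_mul_renergy_le (hE : EnergyPrinciple κ) {μ ν : Measure X} (hμ : μ ∈ Eplus κ)
    (hν : ν ∈ Eplus κ) : 2 * renergy κ μ ν ≤ renergy κ μ μ + renergy κ ν ν := by
  have := ENNReal.toReal_mono (ENNReal.add_lt_top.2 ⟨hμ.2, hν.2⟩).ne (hE μ hμ ν hν).1
  rwa [ENNReal.toReal_add hμ.2.ne hν.2.ne, ENNReal.toReal_mul] at this

theorem renergy_le_iff (hE : EnergyPrinciple κ) {μ ν σ τ : Measure X} (hμ : μ ∈ Eplus κ)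
    (hν : ν ∈ Eplus κ) (hσ : σ ∈ Eplus κ) (hτ : τ ∈ Eplus κ) :
    renergy κ μ ν ≤ renergy κ σ τ ↔ energy κ μ ν ≤ energy κ σ τ :=
  ENNReal.toReal_le_toReal (energy_lt_top hE hμ hν).ne (energy_lt_top hE hσ hτ).ne

theorem strDist_sq (hE : EnergyPrinciple κ) {μ ν : Measure X} (hμ : μ ∈ Eplus κ)
    (hν : ν ∈ Eplus κ) :
    strDist κ μ ν ^ 2 = renergy κ μ μ - 2 * renergy κ μ ν + renergy κ ν ν := by
  have := two_mul_renergy_le hE hμ hν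
  exact Real.sq_sqrt (by unfold renergy at this; linarith)

theorem strDist_nonneg (μ ν : Measure X) : 0 ≤ strDist κ μ ν := Real.sqrt_nonneg _

theorem strDist_comm (h : IsKernel κ) {μ ν : Measure X} (hμ : μ ∈ Eplus κ)
    (hν : ν ∈ Eplus κ) : strDist κ μ ν = strDist κ ν μ := by
  have := renergy_comm h hμ hν
  unfold renergy at this
  rw [strDist, strDist, this]
  congr 1
  ring

/-- One-sided Cauchy–Schwarz inequality for differences of measures. -/
theorem mul_renergy_sub_le (h : IsKernel κ) (hE : EnergyPrinciple κ) {μ ν σ : Measure X}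
    (hμ : μ ∈ Eplus κ) (hν : ν ∈ Eplus κ) (hσ : σ ∈ Eplus κ) (t : ℝ≥0) :
    2 * t * (renergy κ μ σ - renergy κ ν σ) ≤
      strDist κ μ ν ^ 2 + t ^ 2 * renergy κ σ σ := by
  have ht := smul_mem_Eplus h hσ t
  have key := two_mul_renergy_le hE hμ (add_mem_Eplus h hE hν ht)
  rw [strDist_sq hE hμ hν]
  rw [renergy_add_right h hE hν ht hμ, renergy_add_right h hE hν ht (add_mem_Eplus h hE hν ht),
    renergy_add_left hE hν ht hν, renergy_add_left hE hν ht ht] at key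
  simp only [renergy_smul_left, renergy_smul_right h t hσ hμ, renergy_smul_right h t hσ hν,
    renergy_smul_right h t hσ hσ] at key
  rw [renergy_comm h hσ hν] at key
  nlinarith

theorem renergy_sub_le (h : IsKernel κ) (hE : EnergyPrinciple κ) {μ ν σ : Measure X}
    (hμ : μ ∈ Eplus κ) (hν : ν ∈ Eplus κ) (hσ : σ ∈ Eplus κ) :
    renergy κ μ σ - renergy κ ν σ ≤ strDist κ μ ν * (1 + renergy κ σ σ) := by
  have hd := strDist_nonneg (κ := κ) μ ν
  have hs := renergy_nonneg (κ := κ) σ σ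
  rcases hd.eq_or_lt with h0 | h0
  · rw [← h0, zero_mul]
    by_contra! hpos
    set D := renergy κ μ σ - renergy κ ν σ
    obtain ⟨t, ht⟩ : ∃ t : ℝ≥0, (t : ℝ) = D / (1 + renergy κ σ σ) :=
      ⟨⟨_, by positivity⟩, rfl⟩
    have := mul_renergy_sub_le h hE hμ hν hσ t
    rw [← h0, ht] at this
    have hne : 1 + renergy κ σ σ ≠ 0 := by positivity
    have h2 : (D / (1 + renergy κ σ σ)) ^ 2 * renergy κ σ σ ≤ D / (1 + renergy κ σ σ) * D := by
      rw [sq, mul_assoc]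
      gcongr
      rw [div_mul_eq_mul_div, div_le_iff₀ (by positivity)]
      nlinarith
    have h3 : 0 < D / (1 + renergy κ σ σ) * D := by positivity
    simp only [D] at *
    nlinarith
  · obtain ⟨t, ht⟩ : ∃ t : ℝ≥0, (t : ℝ) = strDist κ μ ν := ⟨⟨_, hd⟩, rfl⟩
    have := mul_renergy_sub_le h hE hμ hν hσ t
    rw [ht] at this
    have h1 : strDist κ μ ν * (2 * (renergy κ μ σ - renergy κ ν σ)) ≤
        strDist κ μ ν * (strDist κ μ ν * (1 + renergy κ σ σ)) := by nlinarith
    have h2 := le_of_mul_le_mul_left h1 h0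
    nlinarith [mul_nonneg hd hs]

theorem abs_renergy_sub_le (h : IsKernel κ) (hE : EnergyPrinciple κ) {μ ν σ : Measure X}
    (hμ : μ ∈ Eplus κ) (hν : ν ∈ Eplus κ) (hσ : σ ∈ Eplus κ) :
    |renergy κ μ σ - renergy κ ν σ| ≤ strDist κ μ ν * (1 + renergy κ σ σ) := by
  rw [abs_le']
  refine ⟨renergy_sub_le h hE hμ hν hσ, ?_⟩
  rw [neg_sub, strDist_comm h hμ hν]
  exact renergy_sub_le h hE hν hμ hσ

theorem tendsto_renergy (h : IsKernel κ) (hE : EnergyPrinciple κ) {ι : Type*} {F : Filter ι}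
    {m : ι → Measure X} {ν σ : Measure X} (hm : ∀ i, m i ∈ Eplus κ) (hν : ν ∈ Eplus κ)
    (hσ : σ ∈ Eplus κ) (ht : Tendsto (fun i => strDist κ (m i) ν) F (𝓝 0)) :
    Tendsto (fun i => renergy κ (m i) σ) F (𝓝 (renergy κ ν σ)) := by
  rw [tendsto_iff_dist_tendsto_zero]
  refine squeeze_zero (fun _ => dist_nonneg)
    (fun i => abs_renergy_sub_le h hE (hm i) hν hσ) ?_
  simpa using ht.mul_const (1 + renergy κ σ σ)

theorem tendsto_renergy_self (h : IsKernel κ) (hE : EnergyPrinciple κ) {ι : Type*}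
    {F : Filter ι} {m : ι → Measure X} {ν : Measure X} (hm : ∀ i, m i ∈ Eplus κ)
    (hν : ν ∈ Eplus κ) (ht : Tendsto (fun i => strDist κ (m i) ν) F (𝓝 0)) :
    Tendsto (fun i => renergy κ (m i) (m i)) F (𝓝 (renergy κ ν ν)) := by
  have h1 := (ht.pow 2).add ((tendsto_renergy h hE hm hν hν ht).const_mul 2)
  have h2 := h1.sub_const (renergy κ ν ν)
  refine (h2.congr fun i => ?_).trans (by rw [show (0 : ℝ) ^ 2 + 2 * renergy κ ν ν -
    renergy κ ν ν = renergy κ ν ν by ring])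
  rw [strDist_sq hE (hm i) hν]
  ring

theorem add_le_liminf_add {ι : Type*} {G : Filter ι} {u v : ι → ℝ≥0∞} {a b : ℝ≥0∞}
    (ha : a ≤ liminf u G) (hb : b ≤ liminf v G) : a + b ≤ liminf (fun i => u i + v i) G := by
  refine (add_le_add ha hb).trans ?_
  rw [liminf_eq_iSup_iInf, liminf_eq_iSup_iInf]
  refine ENNReal.biSup_add_biSup_le' ⟨univ, univ_mem⟩ ⟨univ, univ_mem⟩ fun s hs t ht => ?_
  refine le_liminf_of_le (h := ?_)
  filter_upwards [hs, ht] with i hi hj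
  exact add_le_add (iInf₂_le i hi) (iInf₂_le i hj)

theorem mul_le_liminf_mul {ι : Type*} {G : Filter ι} {u : ι → ℝ≥0∞} {a : ℝ≥0∞} (c : ℝ≥0∞)
    (ha : a ≤ liminf u G) : c * a ≤ liminf (fun i => c * u i) G := by
  rcases G.eq_or_neBot with rfl | _
  · simp
  calc c * a ≤ liminf (fun _ => c) G * liminf u G := by rw [liminf_const]; gcongr
    _ ≤ _ := ENNReal.le_liminf_mul

/-- Lower semicontinuous convergence of measures on open sets along a filter. -/
def LowerConv {ι : Type*} (G : Filter ι) (m : ι → Measure X) (ν : Measure X) : Prop :=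
  ∀ U : Set X, IsOpen U → ν U ≤ liminf (fun i => m i U) G

/-- The largest level of `s` strictly below `g x`. -/
noncomputable def levelSup (g : X → ℝ≥0∞) (s : Finset ℝ≥0∞) (x : X) : ℝ≥0∞ :=
  s.sup fun q => if q < g x then q else 0

theorem levelSup_insert (g : X → ℝ≥0∞) {s : Finset ℝ≥0∞} {a : ℝ≥0∞} (ha : ∀ q ∈ s, q < a) :
    levelSup g (insert a s) =
      fun x => levelSup g s x + (g ⁻¹' Ioi a).indicator (fun _ => a - s.sup id) x := by
  ext x
  simp only [levelSup, Finset.sup_insert, indicator, mem_preimage, mem_Ioi]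
  have hs : s.sup id ≤ a := Finset.sup_le fun q hq => (ha q hq).le
  split_ifs with hx
  · have h1 : (s.sup fun q => if q < g x then q else 0) = s.sup id := by
      refine Finset.sup_congr rfl fun q hq => ?_
      rw [if_pos ((ha q hq).trans hx), id]
    rw [h1, sup_eq_left.2 hs, add_tsub_cancel_of_le hs]
  · simp

theorem lintegral_levelSup_le {g : X → ℝ≥0∞} (hg : LowerSemicontinuous g) {ι : Type*}
    {G : Filter ι} {m : ι → Measure X} {ν : Measure X} (h : LowerConv G m ν)
    (s : Finset ℝ≥0∞) :
    ∫⁻ x, levelSup g s x ∂ν ≤ liminf (fun i => ∫⁻ x, levelSup g s x ∂(m i)) G := by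
  classical
  induction s using Finset.induction_on_max with
  | empty => simp [levelSup]
  | insert a s ha ih =>
    have hU : IsOpen (g ⁻¹' Ioi a) := hg.isOpen_preimage a
    have key : ∀ μ : Measure X, ∫⁻ x, levelSup g (insert a s) x ∂μ =
        ∫⁻ x, levelSup g s x ∂μ + (a - s.sup id) * μ (g ⁻¹' Ioi a) := fun μ => by
      rw [levelSup_insert g ha, lintegral_add_right _ (measurable_const.indicator hU.measurableSet),
        lintegral_indicator_const hU.measurableSet]
    simp only [key]
    exact add_le_liminf_add ih (mul_le_liminf_mul _ (h _ hU))

theorem LowerConv.lintegral_le {g : X → ℝ≥0∞} (hg : LowerSemicontinuous g) {ι : Type*}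
    {G : Filter ι} {m : ι → Measure X} {ν : Measure X} (h : LowerConv G m ν) :
    ∫⁻ x, g x ∂ν ≤ liminf (fun i => ∫⁻ x, g x ∂(m i)) G := by
  classical
  let s : ℕ → Finset ℝ≥0∞ := fun n => (Finset.range n).image SimpleFunc.ennrealRatEmbed
  have hle : ∀ n x, levelSup g (s n) x ≤ g x := fun n x =>
    Finset.sup_le fun q _ => by
      split_ifs with hq
      exacts [hq.le, zero_le]
  have hmono : Monotone fun n => levelSup g (s n) := fun i j hij x =>
    Finset.sup_mono (Finset.image_subset_image (Finset.range_mono hij))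
  have hmeas : ∀ n, Measurable (levelSup g (s n)) := fun n => by
    unfold levelSup
    simp only [Finset.sup_eq_iSup]
    refine Measurable.biSup _ (s n).countable_toSet fun q _ => ?_
    exact Measurable.ite (hg.isOpen_preimage q).measurableSet measurable_const measurable_const
  have hsup : ∀ x, ⨆ n, levelSup g (s n) x = g x := fun x => by
    refine le_antisymm (iSup_le fun n => hle n x) (le_of_forall_lt fun c hc => ?_)
    obtain ⟨q, -, hcq, hqg⟩ := ENNReal.lt_iff_exists_rat_btwn.1 hc
    refine hcq.trans_le ?_
    have hk : SimpleFunc.ennrealRatEmbed (Encodable.encode q) = (Real.toNNReal q : ℝ≥0∞) :=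
      SimpleFunc.ennrealRatEmbed_encode q
    refine le_trans ?_ (le_iSup _ (Encodable.encode q + 1))
    have := Finset.le_sup (s := s (Encodable.encode q + 1))
      (f := fun q => if q < g x then q else 0) (b := (Real.toNNReal q : ℝ≥0∞))
      (Finset.mem_image.2 ⟨_, Finset.self_mem_range_succ _, hk⟩)
    rwa [if_pos hqg] at this
  calc ∫⁻ x, g x ∂ν = ∫⁻ x, ⨆ n, levelSup g (s n) x ∂ν := by simp only [hsup]
    _ = ⨆ n, ∫⁻ x, levelSup g (s n) x ∂ν := lintegral_iSup hmeas hmono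
    _ ≤ _ := iSup_le fun n => (lintegral_levelSup_le hg h (s n)).trans
        (liminf_le_liminf (Eventually.of_forall fun i => lintegral_mono (hle n)))

theorem le_of_le_liminf {ι : Type*} {G : Filter ι} [G.NeBot] {u : ι → ℝ≥0∞} {a M : ℝ≥0∞}
    (ha : a ≤ liminf u G) (hu : ∀ᶠ i in G, u i ≤ M) : a ≤ M :=
  ha.trans (liminf_le_of_frequently_le' hu.frequently)

theorem energy_le_of_energy_self_le (hE : EnergyPrinciple κ) {μ ν : Measure X} {M : ℝ≥0∞}
    (hμ : μ ∈ Eplus κ) (hν : ν ∈ Eplus κ) (h : energy κ μ μ ≤ M) (h' : energy κ ν ν ≤ M) :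
    energy κ μ ν ≤ M := by
  have := (hE μ hμ ν hν).1.trans (add_le_add h h')
  rw [← two_mul] at this
  exact (ENNReal.mul_le_mul_iff_right (by norm_num) (by norm_num)).1 this

theorem LowerConv.energy_le (h : IsKernel κ) (hE : EnergyPrinciple κ) {ι : Type*}
    {G : Filter ι} [G.NeBot] {m : ι → Measure X} {ν : Measure X} [SFinite ν] {M : ℝ≥0∞}
    (hm : ∀ i, m i ∈ Eplus κ) (hM : ∀ i, energy κ (m i) (m i) ≤ M)
    (hconv : LowerConv G m ν) : energy κ ν ν ≤ M := by
  have hj : ∀ j, energy κ ν (m j) ≤ M := fun j =>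
    le_of_le_liminf (hconv.lintegral_le (lowerSemicontinuous_pot h (m j)))
      (Eventually.of_forall fun i =>
        energy_le_of_energy_self_le hE (hm i) (hm j) (hM i) (hM j))
  refine le_of_le_liminf (hconv.lintegral_le (lowerSemicontinuous_pot h ν))
    (Eventually.of_forall fun j => ?_)
  have := isLocallyFiniteMeasure_of_mem_Eplus (hm j)
  change energy κ (m j) ν ≤ M
  rw [energy_comm h]
  exact hj j

theorem VagueConv.lowerConv {ι : Type*} {G : Filter ι} {m : ι → Measure X} {ν : Measure X}
    [IsLocallyFiniteMeasure ν] (hm : ∀ i, IsLocallyFiniteMeasure (m i))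
    (h : VagueConv G m ν) : LowerConv G m ν := by
  intro U hU
  refine le_of_forall_lt fun c hc => ?_
  obtain ⟨K, hKU, hK, hcK⟩ := hU.measurableSet.exists_lt_isCompact hc
  obtain ⟨f, hf1, hfc, hfU, hf01⟩ := exists_continuousMap_one_of_isCompact_subset_isOpen hK hU hKU
  have hfint : ∀ μ : Measure X, IsLocallyFiniteMeasure μ →
      ENNReal.ofReal (∫ x, f x ∂μ) = ∫⁻ x, ENNReal.ofReal (f x) ∂μ := fun μ _ =>
    ofReal_integral_eq_lintegral_ofReal (f.continuous.integrable_of_hasCompactSupport hfc)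
      (Eventually.of_forall fun x => (hf01 x).1)
  have hlim := (ENNReal.continuous_ofReal.tendsto _).comp (h f f.continuous hfc)
  have h1 : ν K ≤ ENNReal.ofReal (∫ x, f x ∂ν) := by
    rw [hfint ν inferInstance, ← lintegral_indicator_one hK.measurableSet]
    refine lintegral_mono fun x => ?_
    by_cases hx : x ∈ K
    · simp [hx, hf1 hx]
    · simp [hx]
  rcases G.eq_or_neBot with rfl | _
  · simpa using hc.trans_le le_top
  refine (hcK.trans_le h1).trans_le ?_
  rw [← hlim.liminf_eq]
  refine liminf_le_liminf (Eventually.of_forall fun i => ?_)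
  rw [Function.comp_apply, hfint _ (hm i), ← lintegral_indicator_one hU.measurableSet]
  refine lintegral_mono fun x => ?_
  by_cases hx : x ∈ U
  · simpa [hx] using (hf01 x).2
  · have : f x = 0 := image_eq_zero_of_notMem_tsupport fun h => hx (hfU h)
    simp [this]

theorem kernel_diag_pos (hE : EnergyPrinciple κ) (x : X) : 0 < κ x x := by
  by_contra! h0
  have h0 : κ x x = 0 := le_antisymm h0 zero_le
  have hpot : energy κ (Measure.dirac x) (Measure.dirac x) = 0 := by
    simp [energy, pot, h0]
  have hx : (Measure.dirac x : Measure X) ∈ Eplus κ :=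
    mem_Eplus_of_energy_lt_top (by simp [hpot])
  have := (hE _ hx _ zero_mem_Eplus).2 (by simp [energy, pot, h0])
  exact Measure.dirac_ne_zero this

theorem exists_forall_measure_le (h : IsKernel κ) (hE : EnergyPrinciple κ) {K : Set X}
    (hK : IsCompact K) {M : ℝ≥0∞} (hM : M ≠ ⊤) :
    ∃ C : ℝ≥0∞, C ≠ ⊤ ∧ ∀ m : Measure X, energy κ m m ≤ M → m K ≤ C := by
  refine hK.induction_on (p := fun K => ∃ C : ℝ≥0∞, C ≠ ⊤ ∧
    ∀ m : Measure X, energy κ m m ≤ M → m K ≤ C) ⟨0, by simp, by simp⟩ ?_ ?_ ?_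
  · rintro s t hst ⟨C, hC, h⟩
    exact ⟨C, hC, fun m hm => (measure_mono hst).trans (h m hm)⟩
  · rintro s t ⟨C, hC, h⟩ ⟨C', hC', h'⟩
    exact ⟨C + C', ENNReal.add_ne_top.2 ⟨hC, hC'⟩, fun m hm =>
      (measure_union_le _ _).trans (add_le_add (h m hm) (h' m hm))⟩
  · intro x _
    obtain ⟨c, hc0, hcx⟩ := exists_between (kernel_diag_pos hE x)
    have hc : c ≠ ⊤ := hcx.ne_top
    have hmem : {p : X × X | c < Function.uncurry κ p} ∈ 𝓝 (x, x) :=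
      (h.lsc.isOpen_preimage c).mem_nhds hcx
    obtain ⟨U, hUo, hxU, hU⟩ := exists_nhds_square hmem
    refine ⟨U, mem_nhdsWithin_of_mem_nhds (hUo.mem_nhds hxU), M / c + 1,
      ENNReal.add_ne_top.2 ⟨(ENNReal.div_lt_top hM hc0.ne').ne, by simp⟩, fun m hm => ?_⟩
    have hle : m U * (c * m U) ≤ M := by
      refine le_trans ?_ hm
      calc m U * (c * m U) = ∫⁻ _ in U, (c * m U) ∂m := by simp [mul_comm]
        _ ≤ ∫⁻ x in U, pot κ m x ∂m := by
          refine setLIntegral_mono' hUo.measurableSet fun y hy => ?_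
          calc c * m U = ∫⁻ _ in U, c ∂m := by simp
            _ ≤ ∫⁻ z in U, κ y z ∂m :=
              setLIntegral_mono' hUo.measurableSet fun z hz => (hU (mk_mem_prod hy hz)).le
            _ ≤ pot κ m y := setLIntegral_le_lintegral _ _
        _ ≤ energy κ m m := setLIntegral_le_lintegral _ _
    by_cases h1 : m U ≤ 1
    · exact h1.trans le_add_self
    · push Not at h1
      refine le_trans ?_ le_self_add
      rw [ENNReal.le_div_iff_mul_le (Or.inl hc0.ne') (Or.inl hc)]
      calc m U * c = 1 * (c * m U) := by rw [one_mul, mul_comm]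
        _ ≤ m U * (c * m U) := by gcongr
        _ ≤ M := hle

open scoped CompactlySupported in
theorem exists_vagueConv (h : IsKernel κ) (hE : EnergyPrinciple κ) {ι : Type*}
    (G : Ultrafilter ι) {m : ι → Measure X} {M : ℝ≥0∞} (hM : M ≠ ⊤)
    (hm : ∀ i, m i ∈ Eplus κ) (hmM : ∀ i, energy κ (m i) (m i) ≤ M) :
    ∃ ν : Measure X, IsLocallyFiniteMeasure ν ∧ VagueConv (G : Filter ι) m ν := by
  have hloc := fun i => isLocallyFiniteMeasure_of_mem_Eplus (hm i)
  have hfint : ∀ (f : C_c(X, ℝ)) i, Integrable f (m i) := fun f i =>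
    f.continuous.integrable_of_hasCompactSupport f.hasCompactSupport
  have hlim : ∀ f : C_c(X, ℝ), ∃ a : ℝ, Tendsto (fun i => ∫ x, f x ∂(m i)) G (𝓝 a) := by
    intro f
    obtain ⟨B, hB⟩ := f.hasCompactSupport.exists_bound_of_continuous f.continuous
    obtain ⟨C, hC, hmC⟩ := exists_forall_measure_le h hE f.hasCompactSupport hM
    have hbd : ∀ i, ∫ x, f x ∂(m i) ∈ Metric.closedBall (0 : ℝ) (|B| * C.toReal) := fun i => by
      have hfin : m i (tsupport f) < ⊤ := (hmC _ (hmM i)).trans_lt hC.lt_top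
      rw [mem_closedBall_zero_iff,
        ← setIntegral_eq_integral_of_forall_compl_eq_zero (s := tsupport f)
          fun x hx => image_eq_zero_of_notMem_tsupport hx]
      refine (norm_setIntegral_le_of_norm_le_const hfin
        fun x _ => (hB x).trans (le_abs_self B)).trans ?_
      gcongr
      exact ENNReal.toReal_mono hC (hmC _ (hmM i))
    have hle : ((G.map fun i => ∫ x, f x ∂(m i) : Ultrafilter ℝ) : Filter ℝ) ≤
        𝓟 (Metric.closedBall (0 : ℝ) (|B| * C.toReal)) := by
      rw [le_principal_iff]
      exact Filter.mem_map.2 (univ_mem' hbd)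
    obtain ⟨a, -, ha⟩ := (isCompact_closedBall _ _).ultrafilter_le_nhds _ hle
    exact ⟨a, ha⟩
  choose L hL using hlim
  let Λ₀ : C_c(X, ℝ) →ₗ[ℝ] ℝ :=
    { toFun := L
      map_add' := fun f g => by
        refine tendsto_nhds_unique (hL (f + g)) (((hL f).add (hL g)).congr fun i => ?_)
        rw [← integral_add (hfint f i) (hfint g i)]
        rfl
      map_smul' := fun c f => by
        refine tendsto_nhds_unique (hL (c • f)) (((hL f).const_smul c).congr fun i => ?_)
        rw [← integral_smul]
        rfl }
  let Λ : C_c(X, ℝ) →ₚ[ℝ] ℝ := PositiveLinearMap.mk₀ Λ₀ fun f hf =>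
    ge_of_tendsto' (hL f) fun i => integral_nonneg fun x => hf x
  have : IsLocallyFiniteMeasure (RealRMK.rieszMeasure Λ) :=
    isLocallyFiniteMeasure_of_isFiniteMeasureOnCompacts
  refine ⟨RealRMK.rieszMeasure Λ, this, fun f hf hfc => ?_⟩
  let g : C_c(X, ℝ) := ⟨⟨f, hf⟩, hfc⟩
  have hg := RealRMK.integral_rieszMeasure Λ g
  change Tendsto (fun i => ∫ x, g x ∂(m i)) G (𝓝 (∫ x, g x ∂(RealRMK.rieszMeasure Λ)))
  rw [hg]
  exact hL g

theorem exists_vague_limit (h : IsKernel κ) (hE : EnergyPrinciple κ) {ι : Type*}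
    (G : Ultrafilter ι) {m : ι → Measure X} {M : ℝ≥0∞} (hM : M ≠ ⊤)
    (hm : ∀ i, m i ∈ Eplus κ) (hmM : ∀ i, energy κ (m i) (m i) ≤ M) :
    ∃ ν ∈ Eplus κ, VagueConv (G : Filter ι) m ν ∧ LowerConv (G : Filter ι) m ν := by
  obtain ⟨ν, hν, hconv⟩ := exists_vagueConv h hE G hM hm hmM
  have hlow := hconv.lowerConv fun i => isLocallyFiniteMeasure_of_mem_Eplus (hm i)
  exact ⟨ν, mem_Eplus_of_energy_lt_top ((hlow.energy_le h hE hm hmM).trans_lt hM.lt_top),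
    hconv, hlow⟩

/-- Strong completeness of the cone of measures of finite energy. -/
theorem exists_strong_limit (h : IsKernel κ) (hE : EnergyPrinciple κ) (hC : Consistent κ)
    {m : ℕ → Measure X} {M : ℝ≥0∞} (hM : M ≠ ⊤) (hm : ∀ i, m i ∈ Eplus κ)
    (hmM : ∀ i, energy κ (m i) (m i) ≤ M) (hcauchy : StrongCauchy κ atTop m) :
    ∃ ν ∈ Eplus κ, Tendsto (fun i => strDist κ (m i) ν) atTop (𝓝 0) ∧
      ∀ U : Set X, IsOpen U → (∀ i, m i U = 0) → ν U = 0 := by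
  obtain ⟨ν, hν, hconv, hlow⟩ :=
    exists_vague_limit h hE (Ultrafilter.of (atTop : Filter ℕ)) hM hm hmM
  refine ⟨ν, hν, hC ℕ atTop m inferInstance hm hcauchy ν
    ⟨_, Ultrafilter.of_le _, inferInstance, hconv⟩, fun U hU h0 => ?_⟩
  exact le_antisymm (le_of_le_liminf (hlow U hU) (Eventually.of_forall fun i => (h0 i).le))
    zero_le

theorem concOn_iff {μ : Measure X} {A : Set X} : ConcOn μ A ↔ μ Aᶜ = 0 := by
  refine ⟨fun h => ?_, fun h => ⟨?_, fun K _ => measure_mono_null inter_subset_left h⟩⟩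
  · have : Aᶜ = ⋃ n, Aᶜ ∩ compactCovering X n := by
      rw [← inter_iUnion, iUnion_compactCovering, inter_univ]
    rw [this, measure_iUnion_null_iff]
    exact fun n => h.2 _ (isCompact_compactCovering X n)
  · exact compl_compl A ▸ (NullMeasurableSet.of_null h).compl

theorem mem_EplusOn {μ : Measure X} {A : Set X} :
    μ ∈ EplusOn κ A ↔ μ ∈ Eplus κ ∧ μ Aᶜ = 0 := by
  rw [← concOn_iff]
  rfl

theorem EplusOn_mono {A B : Set X} (hAB : A ⊆ B) : EplusOn κ A ⊆ EplusOn κ B := by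
  intro μ hμ
  rw [mem_EplusOn] at hμ ⊢
  exact ⟨hμ.1, measure_mono_null (compl_subset_compl.2 hAB) hμ.2⟩

theorem innerCap_mono {A B : Set X} (hAB : A ⊆ B) : innerCap κ A ≤ innerCap κ B :=
  ENNReal.inv_le_inv.2 (biInf_mono fun _ hμ => ⟨EplusOn_mono hAB hμ.1, hμ.2⟩)

theorem innerCap_le_outerCap (A : Set X) : innerCap κ A ≤ outerCap κ A :=
  le_iInf₂ fun _ hD => innerCap_mono hD.2

theorem energy_self_ne_zero (hE : EnergyPrinciple κ) {μ : Measure X} (hμ : μ ∈ Eplus κ)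
    (h0 : μ ≠ 0) : energy κ μ μ ≠ 0 := fun h =>
  h0 ((hE μ hμ 0 zero_mem_Eplus).2 (by rw [h]; simp [energy, pot]))

theorem measure_sq_le_innerCap_mul (h : IsKernel κ) (hE : EnergyPrinciple κ) {ν : Measure X}
    (hν : ν ∈ Eplus κ) {N S : Set X} (hS : MeasurableSet S) (hSN : S ⊆ N) (hfin : ν S ≠ ⊤) :
    ν S ^ 2 ≤ innerCap κ N * energy κ ν ν := by
  by_cases h0 : ν S = 0
  · simp [h0]
  have := isLocallyFiniteMeasure_of_mem_Eplus hν
  obtain ⟨c, hc⟩ : ∃ c : ℝ≥0, (c : ℝ≥0∞) = (ν S)⁻¹ :=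
    ⟨_, ENNReal.coe_toNNReal (ENNReal.inv_ne_top.2 h0)⟩
  set σ : Measure X := (c : ℝ≥0∞) • ν.restrict S with hσ
  have hσE : σ ∈ Eplus κ := smul_mem_Eplus h (mem_Eplus_of_le hν Measure.restrict_le_self) c
  have hσ1 : σ univ = 1 := by
    simp [hσ, hc, ENNReal.inv_mul_cancel h0 hfin]
  have hσN : σ Nᶜ = 0 := by
    rw [hσ, Measure.smul_apply, Measure.restrict_apply' hS]
    have : Nᶜ ∩ S = ∅ := by
      rw [← disjoint_iff_inter_eq_empty]
      exact disjoint_compl_left.mono_right hSN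
    simp [this]
  have hσ0 : σ ≠ 0 := fun h => by simp [h] at hσ1
  have hcap : (energy κ σ σ)⁻¹ ≤ innerCap κ N :=
    ENNReal.inv_le_inv.2 (iInf₂_le σ ⟨mem_EplusOn.2 ⟨hσE, hσN⟩, hσ1⟩)
  have hen : ν S ^ 2 * energy κ σ σ ≤ energy κ ν ν := by
    rw [hσ, energy_smul_left, energy_smul_right h, hc, ← mul_assoc, ← mul_assoc, sq,
      mul_assoc (ν S), ENNReal.mul_inv_cancel h0 hfin, mul_one, ENNReal.mul_inv_cancel h0 hfin,
      one_mul]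
    exact energy_mono Measure.restrict_le_self Measure.restrict_le_self
  calc ν S ^ 2 = (energy κ σ σ)⁻¹ * (ν S ^ 2 * energy κ σ σ) := by
        rw [mul_left_comm, ENNReal.inv_mul_cancel (energy_self_ne_zero hE hσE hσ0) hσE.2.ne,
          mul_one]
    _ ≤ innerCap κ N * energy κ ν ν := mul_le_mul' hcap hen

theorem measure_eq_zero_of_innerCap_eq_zero (h : IsKernel κ) (hE : EnergyPrinciple κ)
    {ν : Measure X} (hν : ν ∈ Eplus κ) {N S : Set X} (hN : innerCap κ N = 0)
    (hS : MeasurableSet S) (hSN : S ⊆ N) : ν S = 0 := by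
  by_contra h0
  have := isLocallyFiniteMeasure_of_mem_Eplus hν
  obtain ⟨K, hKS, hK, hνK⟩ := hS.exists_lt_isCompact (pos_iff_ne_zero.2 h0)
  have := measure_sq_le_innerCap_mul h hE hν hK.measurableSet (hKS.trans hSN)
    hK.measure_lt_top.ne
  rw [hN, zero_mul] at this
  exact hνK.ne' (by simpa using this)

theorem exists_of_lt_innerCap {A : Set X} {δ : ℝ≥0∞} (hδ : δ < innerCap κ A) :
    ∃ ν ∈ EplusOn κ A, ν univ = 1 ∧ energy κ ν ν < δ⁻¹ := by
  rw [innerCap, ENNReal.lt_inv_iff_lt_inv] at hδ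
  simp only [iInf_lt_iff] at hδ
  obtain ⟨ν, hν, hlt⟩ := hδ
  exact ⟨ν, hν.1, hν.2, hlt⟩

theorem outerCap_iUnion_eq_zero (h : IsKernel κ) (hE : EnergyPrinciple κ) {N : ℕ → Set X}
    (hN : ∀ n, outerCap κ (N n) = 0) : outerCap κ (⋃ n, N n) = 0 := by
  by_contra h0
  obtain ⟨δ, hδ0, hδ⟩ := exists_between (pos_iff_ne_zero.2 h0)
  obtain ⟨ε, hε0, hε⟩ := ENNReal.exists_pos_sum_of_countable one_ne_zero ℕ
  have hD : ∀ n, ∃ D : Set X, (IsOpen D ∧ N n ⊆ D) ∧ innerCap κ D < (ε n : ℝ≥0∞) ^ 2 * δ := by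
    intro n
    have : outerCap κ (N n) < (ε n : ℝ≥0∞) ^ 2 * δ := by
      rw [hN n]
      exact ENNReal.mul_pos (pow_ne_zero _ (by simpa using (hε0 n).ne')) hδ0.ne'
    simpa only [outerCap, iInf_lt_iff, mem_ofPred_eq, exists_prop] using this
  choose D hDo hDc using hD
  have hlt : δ < innerCap κ (⋃ n, D n) := hδ.trans_le
    (iInf₂_le _ ⟨isOpen_iUnion fun n => (hDo n).1, iUnion_mono fun n => (hDo n).2⟩)
  obtain ⟨ν, hν, hν1, hνE⟩ := exists_of_lt_innerCap hlt
  rw [mem_EplusOn] at hν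
  have hfin : ∀ S, ν S ≠ ⊤ := fun S =>
    ((measure_mono (subset_univ S)).trans_lt (by simp [hν1])).ne
  have hle : ∀ n, ν (D n) ≤ ε n := fun n => by
    have := (measure_sq_le_innerCap_mul h hE hν.1 (hDo n).1.measurableSet subset_rfl
      (hfin _)).trans (mul_le_mul' (hDc n).le hνE.le)
    rw [mul_assoc, ENNReal.mul_inv_cancel hδ0.ne' hδ.ne_top, mul_one] at this
    exact (ENNReal.pow_le_pow_left_iff two_ne_zero).1 this
  have : (1 : ℝ≥0∞) < 1 := calc
    1 = ν (⋃ n, D n) := by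
      rw [← hν1]
      exact (measure_eq_measure_of_null_sdiff (subset_univ _)
        (by rw [← compl_eq_univ_sdiff]; exact hν.2)).symm
    _ ≤ ∑' n, ν (D n) := measure_iUnion_le _
    _ ≤ ∑' n, (ε n : ℝ≥0∞) := ENNReal.tsum_le_tsum hle
    _ < 1 := hε
  exact this.false

theorem outerCap_eq_zero_of_isCompact (h : IsKernel κ) (hE : EnergyPrinciple κ) {K : Set X}
    (hK : IsCompact K) (h0 : innerCap κ K = 0) : outerCap κ K = 0 := by
  by_contra hne
  obtain ⟨δ, hδ0, hδ⟩ := exists_between (pos_iff_ne_zero.2 hne)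
  let ι := {D : Set X // IsOpen D ∧ K ⊆ D}
  have hex : ∀ D : ι, ∃ ν ∈ EplusOn κ D.1, ν univ = 1 ∧ energy κ ν ν < δ⁻¹ := fun D =>
    exists_of_lt_innerCap (hδ.trans_le (iInf₂_le D.1 D.2))
  choose m hm hm1 hmE using hex
  simp only [mem_EplusOn] at hm
  have : Nonempty ι := ⟨⟨univ, isOpen_univ, subset_univ _⟩⟩
  have : IsCodirectedOrder ι := ⟨fun a b =>
    ⟨⟨a.1 ∩ b.1, a.2.1.inter b.2.1, subset_inter a.2.2 b.2.2⟩, inter_subset_left,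
      inter_subset_right⟩⟩
  obtain ⟨ν, hν, hconv, hlow⟩ := exists_vague_limit h hE (Ultrafilter.of (atBot : Filter ι))
    (ENNReal.inv_ne_top.2 hδ0.ne') (fun D => (hm D).1) (fun D => (hmE D).le)
  have hev : ∀ D : ι, ∀ᶠ D' in (Ultrafilter.of (atBot : Filter ι) : Filter ι), D' ≤ D :=
    fun D => Ultrafilter.of_le _ (Iic_mem_atBot D)
  have hKc : ν Kᶜ = 0 := by
    refine measure_null_of_locally_null _ fun x hx => ?_
    obtain ⟨V, U, hVo, hUo, hxV, hKU, hUV⟩ :=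
      SeparatedNhds.of_isCompact_isCompact (isCompact_singleton (x := x)) hK
        (disjoint_singleton_left.2 hx)
    refine ⟨V, mem_nhdsWithin_of_mem_nhds (hVo.mem_nhds (hxV rfl)), ?_⟩
    refine le_antisymm (le_of_le_liminf (hlow V hVo) ?_) zero_le
    filter_upwards [hev ⟨U, hUo, hKU⟩] with D hD
    exact (measure_mono_null (fun y hy hyD => hUV.le_bot ⟨hy, hD hyD⟩) (hm D).2).le
  have hν0 : ν = 0 := by
    rw [← Measure.measure_univ_eq_zero, ← compl_union_self K]
    exact measure_union_null hKc
      (measure_eq_zero_of_innerCap_eq_zero h hE hν h0 hK.measurableSet subset_rfl)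
  obtain ⟨L, hL, hKL⟩ := exists_compact_superset hK
  obtain ⟨f, hf1, hfc, -, -⟩ :=
    exists_continuousMap_one_of_isCompact_subset_isOpen hL isOpen_univ (subset_univ L)
  have hlim := hconv f f.continuous hfc
  rw [hν0, integral_zero_measure] at hlim
  have hone : ∀ᶠ D in (Ultrafilter.of (atBot : Filter ι) : Filter ι), ∫ x, f x ∂(m D) = 1 := by
    filter_upwards [hev ⟨interior L, isOpen_interior, hKL⟩] with D hD
    have hae : ∀ᵐ x ∂(m D), f x = 1 := by
      have hmem : ∀ᵐ x ∂(m D), x ∈ D.1 := (hm D).2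
      filter_upwards [hmem] with x hx
      exact hf1 (interior_subset (hD hx))
    rw [integral_congr_ae hae]
    simp [Measure.real, hm1]
  exact one_ne_zero (tendsto_nhds_unique (tendsto_const_nhds.congr'
    (hone.mono fun _ h => h.symm)) hlim)

theorem outerCap_eq_zero_of_isSigmaCompact (h : IsKernel κ) (hE : EnergyPrinciple κ)
    {N : Set X} (hN : IsSigmaCompact N) (h0 : innerCap κ N = 0) : outerCap κ N = 0 := by
  obtain ⟨K, hK, rfl⟩ := hN
  exact outerCap_iUnion_eq_zero h hE fun n => outerCap_eq_zero_of_isCompact h hE (hK n)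
    (le_antisymm ((innerCap_mono (subset_iUnion K n)).trans h0.le) zero_le)

theorem isSigmaCompact_inter {A B : Set X} (hA : IsSigmaCompact A) (hB : IsSigmaCompact B) :
    IsSigmaCompact (A ∩ B) := by
  obtain ⟨K, hK, rfl⟩ := hA
  obtain ⟨L, hL, rfl⟩ := hB
  simp_rw [iUnion_inter, inter_iUnion]
  exact isSigmaCompact_iUnion _ fun i => isSigmaCompact_iUnion _ fun j =>
    ((hK i).inter (hL j)).isSigmaCompact

theorem isSigmaCompact_setOf_pot_lt (h : IsKernel κ) {A : Set X} (hA : IsSigmaCompact A)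
    (μ ν : Measure X) : IsSigmaCompact {x | x ∈ A ∧ ¬ pot κ μ x ≤ pot κ ν x} := by
  have heq : {x | x ∈ A ∧ ¬ pot κ μ x ≤ pot κ ν x} =
      ⋃ q : ℚ, A ∩ (pot κ ν ⁻¹' Iic (Real.toNNReal q : ℝ≥0∞) ∩
        pot κ μ ⁻¹' Ioi (Real.toNNReal q : ℝ≥0∞)) := by
    ext x
    simp only [not_le, mem_ofPred_eq, mem_iUnion, mem_inter_iff, mem_preimage, mem_Iic, mem_Ioi]
    constructor
    · rintro ⟨hx, hlt⟩
      obtain ⟨q, -, h1, h2⟩ := ENNReal.lt_iff_exists_rat_btwn.1 hlt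
      exact ⟨q, hx, h1.le, h2⟩
    · rintro ⟨q, hx, h1, h2⟩
      exact ⟨hx, h1.trans_lt h2⟩
  rw [heq]
  refine isSigmaCompact_iUnion _ fun q => isSigmaCompact_inter hA (isSigmaCompact_inter ?_ ?_)
  · exact isSigmaCompact_univ.of_isClosed_subset
      ((lowerSemicontinuous_pot h ν).isClosed_preimage _) (subset_univ _)
  · have hU := (lowerSemicontinuous_pot h μ).isOpen_preimage (Real.toNNReal q : ℝ≥0∞)
    have : LocallyCompactSpace (pot κ μ ⁻¹' Ioi (Real.toNNReal q : ℝ≥0∞)) :=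
      hU.locallyCompactSpace
    exact isSigmaCompact_iff_sigmaCompactSpace.2 inferInstance

theorem exists_isSigmaCompact_subset {ν : Measure X} [IsLocallyFiniteMeasure ν] {A : Set X}
    (hA : ν Aᶜ = 0) : ∃ B ⊆ A, IsSigmaCompact B ∧ ν Bᶜ = 0 := by
  set T : Set X := toMeasurable ν Aᶜ
  have hT : MeasurableSet T := measurableSet_toMeasurable _ _
  have hT0 : ν T = 0 := (measure_toMeasurable _).trans hA
  have hTA : Tᶜ ⊆ A := compl_subset_comm.1 (subset_toMeasurable ν Aᶜ)
  have hex : ∀ n k : ℕ, ∃ K ⊆ Tᶜ ∩ spanningSets ν n, IsCompact K ∧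
      ν ((Tᶜ ∩ spanningSets ν n) \ K) < ((k : ℝ≥0∞) + 1)⁻¹ := fun n k =>
    (hT.compl.inter (measurableSet_spanningSets ν n)).exists_isCompact_sdiff_lt
      ((measure_mono inter_subset_right).trans_lt (measure_spanningSets_lt_top ν n)).ne
      (by simp)
  choose K hKs hKc hKν using hex
  refine ⟨⋃ n, ⋃ k, K n k, iUnion₂_subset fun n k => (hKs n k).trans (inter_subset_left.trans hTA),
    isSigmaCompact_iUnion _ fun n => isSigmaCompact_iUnion_of_isCompact _ (hKc n), ?_⟩
  have hsub : (⋃ n, ⋃ k, K n k)ᶜ ⊆ T ∪ ⋃ n, (Tᶜ ∩ spanningSets ν n) \ ⋃ k, K n k := by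
    intro x hx
    by_cases hxT : x ∈ T
    · exact Or.inl hxT
    · have : x ∈ ⋃ n, spanningSets ν n := by simp [iUnion_spanningSets]
      obtain ⟨n, hn⟩ := mem_iUnion.1 this
      exact Or.inr (mem_iUnion.2 ⟨n, ⟨hxT, hn⟩, fun h => hx (mem_iUnion.2 ⟨n, h⟩)⟩)
  refine measure_mono_null hsub (measure_union_null hT0 (measure_iUnion_null fun n => ?_))
  refine le_antisymm (ge_of_tendsto' (x := atTop) (f := fun k : ℕ => ((k : ℝ≥0∞) + 1)⁻¹) ?_
    fun k => (measure_mono (sdiff_subset_sdiff_right (subset_iUnion (K n) k))).trans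
      (hKν n k).le) zero_le
  simpa [Function.comp_def] using ENNReal.tendsto_inv_nat_nhds_zero.comp (tendsto_add_atTop_nat 1)

theorem exists_finite_sUnion_between {B : Set (Set X)} (hB : TopologicalSpace.IsTopologicalBasis B)
    {K U : Set X}
    (hK : IsCompact K) (hU : IsOpen U) (hKU : K ⊆ U) :
    ∃ t : Set (Set X), t.Finite ∧ t ⊆ B ∧ K ⊆ ⋃₀ t ∧ ⋃₀ t ⊆ U := by
  refine hK.induction_on (p := fun K => ∃ t : Set (Set X), t.Finite ∧ t ⊆ B ∧ K ⊆ ⋃₀ t ∧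
    ⋃₀ t ⊆ U) ⟨∅, by simp⟩ ?_ ?_ ?_
  · rintro s t hst ⟨b, h1, h2, h3, h4⟩
    exact ⟨b, h1, h2, hst.trans h3, h4⟩
  · rintro s t ⟨b, h1, h2, h3, h4⟩ ⟨b', h1', h2', h3', h4'⟩
    exact ⟨b ∪ b', h1.union h1', union_subset h2 h2', by
      rw [sUnion_union]; exact union_subset_union h3 h3', by
      rw [sUnion_union]; exact union_subset h4 h4'⟩
  · intro x hx
    obtain ⟨V, hVB, hxV, hVU⟩ := hB.exists_subset_of_mem_open (hKU hx) hU
    exact ⟨V, mem_nhdsWithin_of_mem_nhds ((hB.isOpen hVB).mem_nhds hxV), {V}, by simp,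
      by simpa using hVB, by simp, by simpa using hVU⟩

theorem exists_countable_strong_dense (h : IsKernel κ) (hE : EnergyPrinciple κ)
    {S : Set (Measure X)} (hS : S ⊆ Eplus κ) :
    ∃ D ⊆ S, D.Countable ∧ ∀ ν ∈ S, ∀ ε > 0, ∃ ν' ∈ D, strDist κ ν' ν < ε := by
  let 𝓥 : Set (Set X) :=
    sUnion '' {t : Set (Set X) | t.Finite ∧ t ⊆ TopologicalSpace.countableBasis X}
  let c : Set (Set S) :=
    (⋃ q : ℚ, (fun V => {ν : S | (Real.toNNReal q : ℝ≥0∞) < ν.1 V}) '' 𝓥) ∪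
      range fun q : ℚ => {ν : S | energy κ ν.1 ν.1 < (Real.toNNReal q : ℝ≥0∞)}
  have h𝓥 : 𝓥.Countable :=
    (countable_ofPred_finite_subset (TopologicalSpace.countable_countableBasis X)).image _
  have hc : c.Countable :=
    (countable_iUnion fun q => h𝓥.image _).union (countable_range _)
  let τ : TopologicalSpace S := TopologicalSpace.generateFrom c
  have : SecondCountableTopology S := ⟨c, hc, rfl⟩
  have hopen : ∀ s ∈ c, IsOpen s := fun s hs => TopologicalSpace.isOpen_generateFrom_of_mem hs
  have hlow : ∀ ν : S, LowerConv (𝓝 ν) Subtype.val ν.1 := by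
    intro ν U hU
    have := isLocallyFiniteMeasure_of_mem_Eplus (hS ν.2)
    refine le_of_forall_lt fun a ha => ?_
    obtain ⟨q, -, haq, hqU⟩ := ENNReal.lt_iff_exists_rat_btwn.1 ha
    obtain ⟨K, hKU, hK, hqK⟩ := hU.measurableSet.exists_lt_isCompact hqU
    obtain ⟨t, htf, htB, hKt, htU⟩ :=
      exists_finite_sUnion_between (TopologicalSpace.isBasis_countableBasis X) hK hU hKU
    refine haq.trans_le (le_liminf_of_le (h := ?_))
    have hmem : {ν : S | (Real.toNNReal q : ℝ≥0∞) < ν.1 (⋃₀ t)} ∈ 𝓝 ν :=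
      (hopen _ (Or.inl (mem_iUnion.2 ⟨q, _, ⟨t, ⟨htf, htB⟩, rfl⟩, rfl⟩))).mem_nhds
        (hqK.trans_le (measure_mono hKt))
    filter_upwards [hmem] with ν' hν'
    exact (le_of_lt hν').trans (measure_mono htU)
  have hup : ∀ (ν : S) (a : ℝ≥0∞), energy κ ν.1 ν.1 < a →
      ∀ᶠ ν' : S in 𝓝 ν, energy κ ν'.1 ν'.1 < a := by
    intro ν a ha
    obtain ⟨q, -, hq, hqa⟩ := ENNReal.lt_iff_exists_rat_btwn.1 ha
    have hmem : {ν : S | energy κ ν.1 ν.1 < (Real.toNNReal q : ℝ≥0∞)} ∈ 𝓝 ν :=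
      (hopen _ (Or.inr ⟨q, rfl⟩)).mem_nhds hq
    filter_upwards [hmem] with ν' hν'
    exact lt_trans hν' hqa
  have hev : ∀ (ν : S) (ε : ℝ), 0 < ε → ∀ᶠ ν' : S in 𝓝 ν, strDist κ ν'.1 ν.1 < ε := by
    intro ν ε hε
    have hνE := hS ν.2
    have hη : 0 < ε ^ 2 / 3 := by positivity
    have h1 : ∀ᶠ ν' : S in 𝓝 ν, renergy κ ν'.1 ν'.1 < renergy κ ν.1 ν.1 + ε ^ 2 / 3 := by
      have h0 : energy κ ν.1 ν.1 < ENNReal.ofReal (renergy κ ν.1 ν.1 + ε ^ 2 / 3) := by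
        rw [ENNReal.lt_ofReal_iff_toReal_lt hνE.2.ne]
        exact lt_add_of_pos_right _ hη
      filter_upwards [hup ν _ h0] with ν' hν'
      exact (ENNReal.lt_ofReal_iff_toReal_lt (hS ν'.2).2.ne).1 hν'
    have h2 : ∀ᶠ ν' : S in 𝓝 ν, renergy κ ν.1 ν.1 - ε ^ 2 / 3 ≤ renergy κ ν'.1 ν.1 := by
      by_cases hneg : renergy κ ν.1 ν.1 - ε ^ 2 / 3 ≤ 0
      · exact Eventually.of_forall fun ν' => hneg.trans (renergy_nonneg _ _)
      · have hpos := (not_le.1 hneg).le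
        have h0 : ENNReal.ofReal (renergy κ ν.1 ν.1 - ε ^ 2 / 3) < energy κ ν.1 ν.1 := by
          rw [ENNReal.ofReal_lt_iff_lt_toReal hpos hνE.2.ne]
          exact sub_lt_self _ hη
        have hlim := (hlow ν).lintegral_le (lowerSemicontinuous_pot h ν.1)
        filter_upwards [eventually_lt_of_lt_liminf (h0.trans_le hlim)] with ν' hν'
        exact (ENNReal.ofReal_le_iff_le_toReal (energy_lt_top hE (hS ν'.2) hνE).ne).1 hν'.le
    filter_upwards [h1, h2] with ν' h1 h2
    refine lt_of_pow_lt_pow_left₀ 2 hε.le ?_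
    rw [strDist_sq hE (hS ν'.2) hνE]
    linarith
  obtain ⟨D, hDc, hDd⟩ := TopologicalSpace.exists_countable_dense S
  refine ⟨Subtype.val '' D, by simp, hDc.image _, fun ν hν ε hε => ?_⟩
  obtain ⟨ν', hD', hνε⟩ := hDd.inter_nhds_nonempty (hev ⟨ν, hν⟩ ε hε)
  exact ⟨ν'.1, ⟨ν', hD', rfl⟩, hνε⟩

theorem comb_mem_EplusOn (h : IsKernel κ) (hE : EnergyPrinciple κ) {A : Set X}
    {μ ν : Measure X} (hμ : μ ∈ EplusOn κ A) (hν : ν ∈ EplusOn κ A) (c d : ℝ≥0) :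
    (c : ℝ≥0∞) • μ + (d : ℝ≥0∞) • ν ∈ EplusOn κ A := by
  rw [mem_EplusOn] at *
  exact ⟨add_mem_Eplus h hE (smul_mem_Eplus h hμ.1 c) (smul_mem_Eplus h hν.1 d), by
    simp [hμ.2, hν.2]⟩

theorem renergy_comb_self (h : IsKernel κ) (hE : EnergyPrinciple κ) {μ ν : Measure X}
    (hμ : μ ∈ Eplus κ) (hν : ν ∈ Eplus κ) (c d : ℝ≥0) :
    renergy κ ((c : ℝ≥0∞) • μ + (d : ℝ≥0∞) • ν) ((c : ℝ≥0∞) • μ + (d : ℝ≥0∞) • ν) =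
      c ^ 2 * renergy κ μ μ + 2 * c * d * renergy κ μ ν + d ^ 2 * renergy κ ν ν := by
  have h1 := smul_mem_Eplus h hμ c
  have h2 := smul_mem_Eplus h hν d
  rw [renergy_add_left hE h1 h2 (add_mem_Eplus h hE h1 h2), renergy_add_right h hE h1 h2 h1,
    renergy_add_right h hE h1 h2 h2]
  simp only [renergy_smul_left]
  rw [renergy_smul_right h c hμ hμ, renergy_smul_right h d hν hμ, renergy_smul_right h c hμ hν,
    renergy_smul_right h d hν hν, renergy_comm h hν hμ]
  ring

theorem renergy_comb_right (h : IsKernel κ) (hE : EnergyPrinciple κ) {μ ν σ : Measure X}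
    (hμ : μ ∈ Eplus κ) (hν : ν ∈ Eplus κ) (hσ : σ ∈ Eplus κ) (c d : ℝ≥0) :
    renergy κ σ ((c : ℝ≥0∞) • μ + (d : ℝ≥0∞) • ν) =
      c * renergy κ σ μ + d * renergy κ σ ν := by
  rw [renergy_add_right h hE (smul_mem_Eplus h hμ c) (smul_mem_Eplus h hν d) hσ,
    renergy_smul_right h c hμ hσ, renergy_smul_right h d hν hσ]

theorem exists_gauss_minimizer (h : IsKernel κ) (hE : EnergyPrinciple κ) (hC : Consistent κ)
    {K : Set X} (hK : IsClosed K) {μ : Measure X} (hμ : μ ∈ Eplus κ) :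
    ∃ b ∈ EplusOn κ K, ∀ ν ∈ EplusOn κ K,
      renergy κ b b - 2 * renergy κ μ b ≤ renergy κ ν ν - 2 * renergy κ μ ν := by
  set J : Measure X → ℝ := fun ν => renergy κ ν ν - 2 * renergy κ μ ν with hJ
  have hEp : ∀ {ν}, ν ∈ EplusOn κ K → ν ∈ Eplus κ := fun hν => hν.1
  have h0 : (0 : Measure X) ∈ EplusOn κ K := mem_EplusOn.2 ⟨zero_mem_Eplus, by simp⟩
  have hbdd : BddBelow (J '' EplusOn κ K) := by
    refine ⟨-renergy κ μ μ, ?_⟩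
    rintro _ ⟨ν, hν, rfl⟩
    have := two_mul_renergy_le hE hμ (hEp hν)
    simp only [hJ]
    linarith
  set I : ℝ := sInf (J '' EplusOn κ K) with hI
  have hIle : ∀ ν ∈ EplusOn κ K, I ≤ J ν := fun ν hν => csInf_le hbdd ⟨ν, hν, rfl⟩
  have hex : ∀ i : ℕ, ∃ ν ∈ EplusOn κ K, J ν < I + 1 / ((i : ℝ) + 1) := by
    intro i
    obtain ⟨_, ⟨ν, hν, rfl⟩, hlt⟩ := exists_lt_of_csInf_lt
      (⟨_, 0, h0, rfl⟩ : (J '' EplusOn κ K).Nonempty) (show I < I + 1 / ((i : ℝ) + 1) from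
        lt_add_of_pos_right _ (by positivity))
    exact ⟨ν, hν, hlt⟩
  choose m hm hmJ using hex
  have hpar : ∀ i j, strDist κ (m i) (m j) ^ 2 ≤
      2 * (1 / ((i : ℝ) + 1)) + 2 * (1 / ((j : ℝ) + 1)) := by
    intro i j
    have hmid := hIle _ (comb_mem_EplusOn h hE (hm i) (hm j) (1 / 2) (1 / 2))
    simp only [hJ] at hmid
    rw [renergy_comb_self h hE (hEp (hm i)) (hEp (hm j)),
      renergy_comb_right h hE (hEp (hm i)) (hEp (hm j)) hμ] at hmid
    have hi := hmJ i
    have hj := hmJ j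
    rw [strDist_sq hE (hEp (hm i)) (hEp (hm j))]
    simp only [hJ] at hi hj
    push_cast at hmid
    linarith
  have hcauchy : StrongCauchy κ atTop m := by
    intro ε hε
    obtain ⟨N, hN⟩ := exists_nat_one_div_lt (show 0 < ε ^ 2 / 4 by positivity)
    refine ⟨Ici N, Ici_mem_atTop N, fun i hi j hj => ?_⟩
    refine lt_of_pow_lt_pow_left₀ 2 hε.le ((hpar i j).trans_lt ?_)
    have h1 := Nat.one_div_le_one_div (α := ℝ) (mem_Ici.1 hi)
    have h2 := Nat.one_div_le_one_div (α := ℝ) (mem_Ici.1 hj)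
    linarith
  have hbound : ∀ i, renergy κ (m i) (m i) ≤ 2 * (I + 1) + 4 * renergy κ μ μ := by
    intro i
    have hi := hmJ i
    simp only [hJ] at hi
    have h1 : 1 / ((i : ℝ) + 1) ≤ 1 := by
      rw [div_le_one (by positivity)]
      linarith [(Nat.cast_nonneg i : (0 : ℝ) ≤ i)]
    have h2 := two_mul_renergy_le hE (smul_mem_Eplus h hμ 2) (hEp (hm i))
    rw [renergy_smul_left, renergy_smul_left, renergy_smul_right h 2 hμ hμ] at h2
    push_cast at h2
    linarith
  obtain ⟨b, hb, hlim, hsupp⟩ := exists_strong_limit h hE hC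
    (M := ENNReal.ofReal (2 * (I + 1) + 4 * renergy κ μ μ)) ENNReal.ofReal_ne_top
    (fun i => hEp (hm i)) (fun i => (ENNReal.le_ofReal_iff_toReal_le (hEp (hm i)).2.ne
      ((renergy_nonneg _ _).trans (hbound i))).2 (hbound i)) hcauchy
  refine ⟨b, mem_EplusOn.2 ⟨hb, hsupp _ hK.isOpen_compl fun i => (mem_EplusOn.1 (hm i)).2⟩,
    fun ν hν => le_trans ?_ (hIle ν hν)⟩
  have hcross : Tendsto (fun i => renergy κ μ (m i)) atTop (𝓝 (renergy κ μ b)) := by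
    rw [renergy_comm h hμ hb]
    simp_rw [fun i => renergy_comm h hμ (hEp (hm i))]
    exact tendsto_renergy h hE (fun i => hEp (hm i)) hb hμ hlim
  refine le_of_tendsto_of_tendsto'
    ((tendsto_renergy_self h hE (fun i => hEp (hm i)) hb hlim).sub (hcross.const_mul 2))
    (show Tendsto (fun i : ℕ => I + 1 / ((i : ℝ) + 1)) atTop (𝓝 I) by
      simpa using tendsto_one_div_add_atTop_nhds_zero_nat.const_add I) fun i => (hmJ i).le

theorem nonneg_of_forall_mul_add_sq_nonneg {a b : ℝ}
    (H : ∀ t : ℝ, 0 < t → t ≤ 1 → 0 ≤ t * a + t ^ 2 * b) : 0 ≤ a := by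
  have hlim : Tendsto (fun n : ℕ => a + 1 / ((n : ℝ) + 1) * b) atTop (𝓝 a) := by
    simpa using (tendsto_one_div_add_atTop_nhds_zero_nat.mul_const b).const_add a
  refine ge_of_tendsto' hlim fun n => ?_
  have hpos : 0 < 1 / ((n : ℝ) + 1) := by positivity
  have := H (1 / ((n : ℝ) + 1)) hpos (by
    rw [div_le_one (by positivity)]
    linarith [(Nat.cast_nonneg n : (0 : ℝ) ≤ n)])
  refine (mul_nonneg_iff_of_pos_left hpos).1 ?_
  linarith

theorem exists_projection (h : IsKernel κ) (hE : EnergyPrinciple κ) (hC : Consistent κ)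
    {K : Set X} (hK : IsClosed K) {μ : Measure X} (hμ : μ ∈ Eplus κ) :
    ∃ b ∈ EplusOn κ K, (∀ σ ∈ EplusOn κ K, renergy κ μ σ ≤ renergy κ b σ) ∧
      renergy κ μ b = renergy κ b b := by
  obtain ⟨b, hb, hmin⟩ := exists_gauss_minimizer h hE hC hK hμ
  have hvar : ∀ σ ∈ EplusOn κ K, renergy κ μ σ ≤ renergy κ b σ := by
    intro σ hσ
    have : 0 ≤ 2 * (renergy κ b σ - renergy κ μ σ) := by
      refine nonneg_of_forall_mul_add_sq_nonneg (b := renergy κ σ σ) fun t ht _ => ?_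
      lift t to ℝ≥0 using ht.le
      have := hmin _ (comb_mem_EplusOn h hE hb hσ 1 t)
      rw [renergy_comb_self h hE hb.1 hσ.1, renergy_comb_right h hE hb.1 hσ.1 hμ] at this
      push_cast at this
      linarith
    linarith
  refine ⟨b, hb, hvar, le_antisymm (hvar b hb) ?_⟩
  have : 0 ≤ 2 * (renergy κ μ b - renergy κ b b) := by
    refine nonneg_of_forall_mul_add_sq_nonneg (b := renergy κ b b) fun t ht ht1 => ?_
    lift t to ℝ≥0 using ht.le
    have ht1' : t ≤ 1 := by exact_mod_cast ht1
    have := hmin _ (comb_mem_EplusOn h hE hb hb (1 - t) 0)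
    rw [renergy_comb_self h hE hb.1 hb.1, renergy_comb_right h hE hb.1 hb.1 hμ,
      NNReal.coe_sub ht1'] at this
    push_cast at this
    linarith
  linarith

theorem eq_zero_of_energy_le (h : IsKernel κ) (hE : EnergyPrinciple κ) {μ ν σ : Measure X}
    (hμ : μ ∈ Eplus κ) (hν : ν ∈ Eplus κ) (hσ : σ ∈ Eplus κ) (hle : energy κ σ μ ≤ energy κ σ ν)
    (hlt : ∀ᵐ x ∂σ, pot κ ν x < pot κ μ x) : σ = 0 := by
  by_contra h0
  have := isLocallyFiniteMeasure_of_mem_Eplus hμ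
  exact (lintegral_strict_mono h0 (measurable_pot h μ).aemeasurable
    (energy_lt_top hE hσ hν).ne hlt).not_ge hle

theorem neOn_of_forall_renergy_le (h : IsKernel κ) (hE : EnergyPrinciple κ) {μ ν : Measure X}
    (hμ : μ ∈ Eplus κ) (hν : ν ∈ Eplus κ) {A : Set X}
    (hle : ∀ σ ∈ EplusOn κ A, renergy κ μ σ ≤ renergy κ ν σ) :
    NEOn κ A fun x => pot κ μ x ≤ pot κ ν x := by
  by_contra h0
  obtain ⟨σ, hσ, hσ1, -⟩ := exists_of_lt_innerCap (pos_iff_ne_zero.2 h0)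
  have hσA : σ ∈ EplusOn κ A := EplusOn_mono (fun x hx => hx.1) hσ
  have hσ0 : σ = 0 := by
    refine eq_zero_of_energy_le h hE hμ hν hσ.1 ((renergy_le_iff hE hσ.1 hμ hσ.1 hν).1 ?_) ?_
    · rw [renergy_comm h hσ.1 hμ, renergy_comm h hσ.1 hν]
      exact hle σ hσA
    · have hN : ∀ᵐ x ∂σ, x ∈ {x | x ∈ A ∧ ¬ pot κ μ x ≤ pot κ ν x} := (mem_EplusOn.1 hσ).2
      filter_upwards [hN] with x hx
      exact not_le.1 hx.2
  simp [hσ0] at hσ1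

theorem NEOn.ae_le (h : IsKernel κ) (hE : EnergyPrinciple κ) {μ ν σ : Measure X}
    (hμ : μ ∈ Eplus κ) (hν : ν ∈ Eplus κ) {K : Set X} (hK : MeasurableSet K)
    (hσ : σ ∈ EplusOn κ K) (hne : NEOn κ K fun x => pot κ μ x ≤ pot κ ν x) :
    ∀ᵐ x ∂σ, pot κ μ x ≤ pot κ ν x := by
  have := isLocallyFiniteMeasure_of_mem_Eplus hμ
  have := isLocallyFiniteMeasure_of_mem_Eplus hν
  have hmeas : MeasurableSet {x | x ∈ K ∧ ¬ pot κ μ x ≤ pot κ ν x} :=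
    hK.inter (measurableSet_le (measurable_pot h μ) (measurable_pot h ν)).compl
  have h0 := measure_eq_zero_of_innerCap_eq_zero h hE hσ.1 hne hmeas subset_rfl
  refine measure_mono_null (fun x hx => ?_) (measure_union_null h0 (mem_EplusOn.1 hσ).2)
  by_cases hxK : x ∈ K
  · exact Or.inl ⟨hxK, hx⟩
  · exact Or.inr hxK

theorem NEOn.mono {A B : Set X} {P : X → Prop} (hP : NEOn κ B P) (hAB : A ⊆ B) : NEOn κ A P :=
  le_antisymm ((innerCap_mono (inter_subset_inter_left _ hAB)).trans (le_of_eq hP)) zero_le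

theorem InnerLam_anti {A B : Set X} (hAB : A ⊆ B) (μ : Measure X) :
    InnerLam κ B μ ⊆ InnerLam κ A μ :=
  fun _ hν => ⟨hν.1, NEOn.mono hν.2 hAB⟩

theorem OuterLam_subset_InnerLam (A : Set X) (μ : Measure X) :
    OuterLam κ A μ ⊆ InnerLam κ A μ :=
  fun _ hν => ⟨hν.1, le_antisymm ((innerCap_le_outerCap _).trans (le_of_eq hν.2)) zero_le⟩

theorem InnerLam_subset_OuterLam (h : IsKernel κ) (hE : EnergyPrinciple κ) {A : Set X}
    (hA : IsSigmaCompact A) (μ : Measure X) : InnerLam κ A μ ⊆ OuterLam κ A μ :=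
  fun ν hν => ⟨hν.1, outerCap_eq_zero_of_isSigmaCompact h hE
    (isSigmaCompact_setOf_pot_lt h hA μ ν) hν.2⟩

theorem pot_le_of_tendsto (h : IsKernel κ) (hE : EnergyPrinciple κ) (hD : Domination κ)
    {m : ℕ → Measure X} {b ν : Measure X} (hm : ∀ n, m n ∈ Eplus κ) (hb : b ∈ Eplus κ)
    (hν : ν ∈ Eplus κ) (hlim : Tendsto (fun n => strDist κ (m n) b) atTop (𝓝 0))
    (hle : ∀ n x, pot κ (m n) x ≤ pot κ ν x) (x : X) : pot κ b x ≤ pot κ ν x := by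
  have := isLocallyFiniteMeasure_of_mem_Eplus hb
  have := isLocallyFiniteMeasure_of_mem_Eplus hν
  refine hD b hb ν hν ?_ x
  set N : Set X := {x | pot κ ν x < pot κ b x}
  have hN : MeasurableSet N := measurableSet_lt (measurable_pot h ν) (measurable_pot h b)
  have hσ : b.restrict N ∈ Eplus κ := mem_Eplus_of_le hb Measure.restrict_le_self
  have hσ0 : b.restrict N = 0 := by
    refine eq_zero_of_energy_le h hE hb hν hσ ((renergy_le_iff hE hσ hb hσ hν).1 ?_)
      (ae_restrict_mem hN)
    rw [renergy_comm h hσ hb]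
    refine le_of_tendsto' (tendsto_renergy h hE hm hb hσ hlim) fun n => ?_
    rw [renergy_comm h (hm n) hσ, renergy_le_iff hE hσ (hm n) hσ hν]
    exact lintegral_mono (hle n)
  have hbN : b N = 0 := by rw [← Measure.restrict_apply_self, hσ0]; simp
  have hae : ∀ᵐ x ∂b, x ∉ N := measure_eq_zero_iff_ae_notMem.1 hbN
  filter_upwards [hae] with x hx
  exact not_lt.1 hx

theorem strDist_sq_projection_le (h : IsKernel κ) (hE : EnergyPrinciple κ) {A : Set X}
    {μ b σ : Measure X} (hb : b ∈ Eplus κ)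
    (hvar : ∀ σ ∈ EplusOn κ A, renergy κ μ σ ≤ renergy κ b σ) (hσ : σ ∈ EplusOn κ A)
    (heq : renergy κ μ σ = renergy κ σ σ) :
    strDist κ σ b ^ 2 ≤ renergy κ b b - renergy κ σ σ := by
  have h1 := hvar σ hσ
  rw [strDist_sq hE hσ.1 hb, renergy_comm h hσ.1 hb]
  linarith

theorem strongCauchy_of_sq_le {m : ℕ → Measure X} (h : IsKernel κ) (hm : ∀ n, m n ∈ Eplus κ)
    {e : ℕ → ℝ} (hbdd : BddAbove (range e))
    (hle : ∀ i j, i ≤ j → strDist κ (m i) (m j) ^ 2 ≤ e j - e i) : StrongCauchy κ atTop m := by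
  have hmono : Monotone e := fun i j hij => sub_nonneg.1 ((sq_nonneg _).trans (hle i j hij))
  intro ε hε
  obtain ⟨N, hN⟩ := exists_lt_of_lt_ciSup (sub_lt_self (⨆ n, e n) (show 0 < ε ^ 2 by positivity))
  have key : ∀ i j, N ≤ i → i ≤ j → strDist κ (m i) (m j) < ε := by
    intro i j hi hij
    refine lt_of_pow_lt_pow_left₀ 2 hε.le ((hle i j hij).trans_lt ?_)
    have h1 := hmono hi
    have h2 := le_ciSup hbdd j
    linarith
  refine ⟨Ici N, Ici_mem_atTop N, fun i hi j hj => ?_⟩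
  rcases le_total i j with hij | hij
  · exact key i j hi hij
  · rw [strDist_comm h (hm i) (hm j)]
    exact key j i hj hij

theorem energy_le_of_forall_restrict {K : ℕ → Set X} (h : IsKernel κ) (hmono : Monotone K)
    {μ b σ : Measure X} [SFinite μ] [SFinite b] [SFinite σ] (hσ : σ (⋃ n, K n)ᶜ = 0)
    (hle : ∀ n, energy κ μ (σ.restrict (K n)) ≤ energy κ b (σ.restrict (K n))) :
    energy κ μ σ ≤ energy κ b σ := by
  have hres : σ.restrict (⋃ n, K n) = σ := Measure.restrict_eq_self_of_ae_mem hσ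
  rw [energy_comm h μ σ, energy, ← hres,
    setLIntegral_iUnion_of_directed _ hmono.directed_le, hres]
  refine iSup_le fun n => ?_
  change energy κ (σ.restrict (K n)) μ ≤ _
  rw [energy_comm h]
  exact (hle n).trans (energy_mono le_rfl Measure.restrict_le_self)

theorem exists_projection_iUnion (h : IsKernel κ) (hE : EnergyPrinciple κ) (hC : Consistent κ)
    {K : ℕ → Set X} (hK : ∀ n, IsCompact (K n)) (hmono : Monotone K) {μ : Measure X}
    (hμ : μ ∈ Eplus κ) :
    ∃ b ∈ Eplus κ, (∀ σ ∈ EplusOn κ (⋃ n, K n), renergy κ μ σ ≤ renergy κ b σ) ∧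
      ∃ m : ℕ → Measure X, (∀ n, m n ∈ EplusOn κ (K n)) ∧
        (∀ n, ∀ σ ∈ EplusOn κ (K n), renergy κ μ σ ≤ renergy κ (m n) σ) ∧
        (∀ n, renergy κ μ (m n) = renergy κ (m n) (m n)) ∧
        Tendsto (fun n => strDist κ (m n) b) atTop (𝓝 0) := by
  choose m hm hvar heq using fun n => exists_projection h hE hC (hK n).isClosed hμ
  have hmE : ∀ n, m n ∈ Eplus κ := fun n => (hm n).1
  have hbound : ∀ n, renergy κ (m n) (m n) ≤ renergy κ μ μ := fun n => by
    have := two_mul_renergy_le hE hμ (hmE n)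
    linarith [heq n]
  have hcauchy : StrongCauchy κ atTop m :=
    strongCauchy_of_sq_le h hmE (e := fun n => renergy κ (m n) (m n))
      ⟨renergy κ μ μ, by rintro _ ⟨n, rfl⟩; exact hbound n⟩ fun i j hij =>
      strDist_sq_projection_le h hE (hmE j) (hvar j) (EplusOn_mono (hmono hij) (hm i)) (heq i)
  obtain ⟨b, hb, hlim, -⟩ := exists_strong_limit h hE hC hμ.2.ne hmE
    (fun n => (renergy_le_iff hE (hmE n) (hmE n) hμ hμ).1 (hbound n)) hcauchy
  refine ⟨b, hb, fun σ hσ => ?_, m, hm, hvar, heq, hlim⟩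
  have := isLocallyFiniteMeasure_of_mem_Eplus hμ
  have := isLocallyFiniteMeasure_of_mem_Eplus hb
  have := isLocallyFiniteMeasure_of_mem_Eplus hσ.1
  rw [renergy_le_iff hE hμ hσ.1 hb hσ.1]
  refine energy_le_of_forall_restrict h hmono (mem_EplusOn.1 hσ).2 fun n => ?_
  have hσn : σ.restrict (K n) ∈ EplusOn κ (K n) := mem_EplusOn.2
    ⟨mem_Eplus_of_le hσ.1 Measure.restrict_le_self,
      by simp [Measure.restrict_apply (hK n).measurableSet.compl]⟩
  rw [← renergy_le_iff hE hμ hσn.1 hb hσn.1]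
  refine ge_of_tendsto (tendsto_renergy h hE hmE hb hσn.1 hlim) ?_
  filter_upwards [eventually_ge_atTop n] with k hk
  exact hvar k _ (EplusOn_mono (hmono hk) hσn)

theorem renergy_le_of_dense (h : IsKernel κ) (hE : EnergyPrinciple κ) {S D : Set (Measure X)}
    (hS : S ⊆ Eplus κ) (hDS : D ⊆ S)
    (hdense : ∀ ν ∈ S, ∀ ε > 0, ∃ ν' ∈ D, strDist κ ν' ν < ε) {μ b : Measure X}
    (hμ : μ ∈ Eplus κ) (hb : b ∈ Eplus κ) (hle : ∀ σ ∈ D, renergy κ μ σ ≤ renergy κ b σ) :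
    ∀ σ ∈ S, renergy κ μ σ ≤ renergy κ b σ := by
  intro σ hσ
  choose s hsD hs using fun n : ℕ => hdense σ hσ (1 / ((n : ℝ) + 1)) (by positivity)
  have hsE : ∀ n, s n ∈ Eplus κ := fun n => hS (hDS (hsD n))
  have hlim : Tendsto (fun n => strDist κ (s n) σ) atTop (𝓝 0) :=
    squeeze_zero (fun n => strDist_nonneg _ _) (fun n => (hs n).le)
      tendsto_one_div_add_atTop_nhds_zero_nat
  rw [renergy_comm h hμ (hS hσ), renergy_comm h hb (hS hσ)]
  refine le_of_tendsto_of_tendsto' (tendsto_renergy h hE hsE (hS hσ) hμ hlim)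
    (tendsto_renergy h hE hsE (hS hσ) hb hlim) fun n => ?_
  rw [renergy_comm h (hsE n) hμ, renergy_comm h (hsE n) hb]
  exact hle _ (hsD n)

theorem pot_projection_le (h : IsKernel κ) (hE : EnergyPrinciple κ) (hD : Domination κ)
    {K : Set X} (hK : MeasurableSet K) {μ m ν : Measure X} (hμ : μ ∈ Eplus κ)
    (hm : m ∈ EplusOn κ K) (hvar : ∀ σ ∈ EplusOn κ K, renergy κ μ σ ≤ renergy κ m σ)
    (heq : renergy κ μ m = renergy κ m m) (hν : ν ∈ InnerLam κ K μ) (x : X) :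
    pot κ m x ≤ pot κ ν x := by
  have := isLocallyFiniteMeasure_of_mem_Eplus hm.1
  have h1 : pot κ μ ≤ᵐ[m] pot κ m :=
    NEOn.ae_le h hE hμ hm.1 hK hm (neOn_of_forall_renergy_le h hE hμ hm.1 hvar)
  have h2 := NEOn.ae_le h hE hμ hν.1 hK hm hν.2
  have hle : energy κ m m ≤ energy κ m μ := by
    rw [← renergy_le_iff hE hm.1 hm.1 hm.1 hμ, renergy_comm h hm.1 hμ, heq]
  have h3 := ae_eq_of_ae_le_of_lintegral_le h1 (energy_lt_top hE hm.1 hμ).ne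
    (measurable_pot h m).aemeasurable hle
  refine hD m hm.1 ν hν.1 ?_ x
  filter_upwards [h2, h3] with y hy hy'
  exact hy'.ge.trans hy

theorem exists_isSigmaCompact_concentrating (h : IsKernel κ) (hE : EnergyPrinciple κ)
    (A : Set X) : ∃ A₀ ⊆ A, IsSigmaCompact A₀ ∧ ∀ μ ∈ Eplus κ, ∀ b ∈ Eplus κ,
      (∀ σ ∈ EplusOn κ A₀, renergy κ μ σ ≤ renergy κ b σ) →
        ∀ σ ∈ EplusOn κ A, renergy κ μ σ ≤ renergy κ b σ := by
  obtain ⟨D, hDA, hDc, hdense⟩ :=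
    exists_countable_strong_dense h hE (S := EplusOn κ A) fun _ hν => hν.1
  have hB : ∀ ν : Measure X, ∃ B ⊆ A, IsSigmaCompact B ∧ (ν ∈ D → ν Bᶜ = 0) := by
    intro ν
    by_cases hν : ν ∈ D
    · have := isLocallyFiniteMeasure_of_mem_Eplus (hDA hν).1
      obtain ⟨B, h1, h2, h3⟩ := exists_isSigmaCompact_subset (mem_EplusOn.1 (hDA hν)).2
      exact ⟨B, h1, h2, fun _ => h3⟩
    · exact ⟨∅, empty_subset _, isSigmaCompact_empty, fun hν' => absurd hν' hν⟩
  choose B hBA hBc hBν using hB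
  refine ⟨⋃ ν ∈ D, B ν, iUnion₂_subset fun ν _ => hBA ν,
    isSigmaCompact_biUnion hDc fun ν _ => hBc ν,
    fun μ hμ b hb hle => renergy_le_of_dense h hE (fun _ hν => hν.1) hDA hdense hμ hb
      fun σ hσ => hle σ (mem_EplusOn.2 ⟨(hDA hσ).1, ?_⟩)⟩
  exact measure_mono_null (compl_subset_compl.2 (subset_biUnion_of_mem (u := B) hσ)) (hBν σ hσ)

end Auxiliary

/-- Reduction of inner balayage to a `K_σ`-subset: there is a σ-compact `A₀ ⊆ A`,
independent of `μ`, with `μ^A = μ^{A₀} = μ^{*A₀}` for all `μ ∈ E⁺`. -/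
theorem statement4 [SecondCountableTopology X] (κ : X → X → ℝ≥0∞) (hker : IsKernel κ)
    (hE : EnergyPrinciple κ) (hC : Consistent κ) (hD : Domination κ) (hA2 : A2 κ) :
    ∀ A : Set X, ∃ A₀ : Set X, A₀ ⊆ A ∧ IsSigmaCompact A₀ ∧
      ∀ μ ∈ Eplus κ, ∃ b : Measure X,
        IsInnerBal κ A μ b ∧ IsInnerBal κ A₀ μ b ∧ IsOuterBal κ A₀ μ b := by
  intro A
  obtain ⟨A₀, hA₀, hσc, hdense⟩ := exists_isSigmaCompact_concentrating hker hE A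
  refine ⟨A₀, hA₀, hσc, fun μ hμ => ?_⟩
  obtain ⟨K, hK, hKA⟩ := hσc
  have hcover : ⋃ n, accumulate K n = A₀ := (iUnion_accumulate).trans hKA
  have hcompact : ∀ n, IsCompact (accumulate K n) := isCompact_accumulate hK
  obtain ⟨b, hb, hle, m, hm, hvar, heq, hlim⟩ :=
    exists_projection_iUnion hker hE hC hcompact monotone_accumulate hμ
  rw [hcover] at hle
  have hbA : b ∈ InnerLam κ A μ :=
    ⟨hb, neOn_of_forall_renergy_le hker hE hμ hb (hdense μ hμ b hb hle)⟩
  have hbA₀ : b ∈ InnerLam κ A₀ μ := InnerLam_anti hA₀ μ hbA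
  have hmin : ∀ ν ∈ InnerLam κ A₀ μ, ∀ x, pot κ b x ≤ pot κ ν x := fun ν hν =>
    pot_le_of_tendsto hker hE hD (fun n => (hm n).1) hb hν.1 hlim fun n =>
      pot_projection_le hker hE hD (hcompact n).measurableSet hμ (hm n) (hvar n) (heq n)
        (InnerLam_anti (hcover ▸ subset_iUnion _ n) μ hν)
  exact ⟨b, ⟨hbA, fun ν hν => hmin ν (InnerLam_anti hA₀ μ hν)⟩, ⟨hbA₀, hmin⟩,
    InnerLam_subset_OuterLam hker hE ⟨K, hK, hKA⟩ μ hbA₀,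
    fun ν hν => hmin ν (OuterLam_subset_InnerLam A₀ μ hν)⟩

end Balayage
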